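/- Let p₁, p₂, q ∈ {1, …, h − 1} be pairwise distinct and let s₁ and s₂ be surface slots that are (p₁, p₂, q)-paired. Let g be any STM move, rotating a slice of index v, and suppose that it is not the case that |v| ∈ {p₁, p₂} and g moves s₁ or s₂. Then the surface slots g(s₁) and g(s₂) are (p₁, p₂, q)-paired. -/

import Mathlib

namespace RC

/-- The six signed coordinate directions. -/
inductive Dir : Type
  | xp | xn | yp | yn | zp | zn
  deriving DecidableEq

/-- Nonzero slice coordinates of absolute value at most `h`. -/
def I (h : ℕ) : Type := {i : ℤ // i ≠ 0 ∧ |i| ≤ (h : ℤ)}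

instance (h : ℕ) : DecidableEq (I h) :=
  inferInstanceAs (DecidableEq {i : ℤ // i ≠ 0 ∧ |i| ≤ (h : ℤ)})

instance (h : ℕ) : Neg (I h) :=
  ⟨fun i => ⟨-i.1, neg_ne_zero.mpr i.2.1, by rw [abs_neg]; exact i.2.2⟩⟩

@[simp] theorem I.neg_neg {h : ℕ} (i : I h) : -(-i) = i :=
  Subtype.ext (by show -(-i.1) = i.1; exact _root_.neg_neg i.1)

/-- Sticker slots of the cube: a cubie position together with a face direction. -/
abbrev S (h : ℕ) : Type := (I h × I h × I h) × Dir

/-- Rotation of directions by a clockwise `x` turn: fixes `±x`,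
`+y ↦ −z ↦ −y ↦ +z ↦ +y`. -/
def rotX : Dir → Dir
  | .xp => .xp | .xn => .xn | .yp => .zn | .zn => .yn | .yn => .zp | .zp => .yp

def rotXi : Dir → Dir
  | .xp => .xp | .xn => .xn | .zn => .yp | .yn => .zn | .zp => .yn | .yp => .zp

/-- Rotation of directions by a clockwise `y` turn: fixes `±y`,
`+z ↦ −x ↦ −z ↦ +x ↦ +z`. -/
def rotY : Dir → Dir
  | .yp => .yp | .yn => .yn | .zp => .xn | .xn => .zn | .zn => .xp | .xp => .zp

def rotYi : Dir → Dir
  | .yp => .yp | .yn => .yn | .xn => .zp | .zn => .xn | .xp => .zn | .zp => .xp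

/-- Rotation of directions by a clockwise `z` turn: fixes `±z`,
`+x ↦ −y ↦ −x ↦ +y ↦ +x`. -/
def rotZ : Dir → Dir
  | .zp => .zp | .zn => .zn | .xp => .yn | .yn => .xn | .xn => .yp | .yp => .xp

def rotZi : Dir → Dir
  | .zp => .zp | .zn => .zn | .yn => .xp | .xn => .yn | .yp => .xn | .xp => .yp

@[simp] theorem rotXi_rotX (d : Dir) : rotXi (rotX d) = d := by cases d <;> rfl
@[simp] theorem rotX_rotXi (d : Dir) : rotX (rotXi d) = d := by cases d <;> rfl
@[simp] theorem rotYi_rotY (d : Dir) : rotYi (rotY d) = d := by cases d <;> rfl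
@[simp] theorem rotY_rotYi (d : Dir) : rotY (rotYi d) = d := by cases d <;> rfl
@[simp] theorem rotZi_rotZ (d : Dir) : rotZi (rotZ d) = d := by cases d <;> rfl
@[simp] theorem rotZ_rotZi (d : Dir) : rotZ (rotZi d) = d := by cases d <;> rfl

/-- Clockwise quarter turn of the `x = v` slice (as seen from positive `x`). -/
def X {h : ℕ} (v : I h) : Equiv.Perm (S h) where
  toFun s := if s.1.1 = v then ((s.1.1, s.1.2.2, -s.1.2.1), rotX s.2) else s
  invFun s := if s.1.1 = v then ((s.1.1, -s.1.2.2, s.1.2.1), rotXi s.2) else s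
  left_inv := by
    rintro ⟨⟨x, y, z⟩, d⟩
    by_cases hx : x = v <;> simp [hx]
  right_inv := by
    rintro ⟨⟨x, y, z⟩, d⟩
    by_cases hx : x = v <;> simp [hx]

/-- Clockwise quarter turn of the `y = v` slice (as seen from positive `y`). -/
def Y {h : ℕ} (v : I h) : Equiv.Perm (S h) where
  toFun s := if s.1.2.1 = v then ((-s.1.2.2, s.1.2.1, s.1.1), rotY s.2) else s
  invFun s := if s.1.2.1 = v then ((s.1.2.2, s.1.2.1, -s.1.1), rotYi s.2) else s
  left_inv := by
    rintro ⟨⟨x, y, z⟩, d⟩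
    by_cases hy : y = v <;> simp [hy]
  right_inv := by
    rintro ⟨⟨x, y, z⟩, d⟩
    by_cases hy : y = v <;> simp [hy]

/-- Clockwise quarter turn of the `z = v` slice (as seen from positive `z`). -/
def Z {h : ℕ} (v : I h) : Equiv.Perm (S h) where
  toFun s := if s.1.2.2 = v then ((s.1.2.1, -s.1.1, s.1.2.2), rotZ s.2) else s
  invFun s := if s.1.2.2 = v then ((-s.1.2.1, s.1.1, s.1.2.2), rotZi s.2) else s
  left_inv := by
    rintro ⟨⟨x, y, z⟩, d⟩
    by_cases hz : z = v <;> simp [hz]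
  right_inv := by
    rintro ⟨⟨x, y, z⟩, d⟩
    by_cases hz : z = v <;> simp [hz]

/-- The side-length parameter: `h = m + 3n`. -/
abbrev hC (n m : ℕ) : ℕ := m + 3 * n

def bit {m : ℕ} (w : Fin m → Bool) (c : ℤ) : Bool :=
  if hc : 1 ≤ c ∧ c ≤ (m : ℤ) then w ⟨(c - 1).toNat, by omega⟩ else false

/-- The `x`-slice index corresponding to bit position `j`. -/
def colIdx {n m : ℕ} (j : Fin m) : I (hC n m) :=
  ⟨((j : ℕ) : ℤ) + 1, by
    have hj : (j : ℕ) < m := j.isLt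
    constructor
    · omega
    · rw [abs_of_nonneg (by omega)]; push_cast; omega⟩

/-- The `z`-slice index `m + i` corresponding to row `i`. -/
def zIdx {n m : ℕ} (i : Fin n) : I (hC n m) :=
  ⟨(m : ℤ) + ((i : ℕ) : ℤ) + 1, by
    have hi : (i : ℕ) < n := i.isLt
    constructor
    · omega
    · rw [abs_of_nonneg (by omega)]; push_cast; omega⟩

/-- The face coordinate `h`. -/
def topI {n m : ℕ} (H : 0 < m + 3 * n) : I (hC n m) :=
  ⟨(m : ℤ) + 3 * (n : ℤ), by
    constructor
    · omega
    · rw [abs_of_nonneg (by omega)]; push_cast; omega⟩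

/-- `aᵢ := (X 1)^{lᵢ(1)} ⋯ (X m)^{lᵢ(m)}`. -/
def a {n m : ℕ} (l : Fin n → Fin m → Bool) (i : Fin n) : Equiv.Perm (S (hC n m)) :=
  ((List.finRange m).map (fun j => X (colIdx (n := n) j) ^ (if l i j then 1 else 0))).prod

/-- `bᵢ := aᵢ⁻¹ · (Z (m+i)) · aᵢ`. -/
def b {n m : ℕ} (l : Fin n → Fin m → Bool) (i : Fin n) : Equiv.Perm (S (hC n m)) :=
  (a l i)⁻¹ * Z (zIdx (m := m) i) * a l i

/-- `t := a₁ · b₁ · b₂ ⋯ bₙ`. -/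
def t {n m : ℕ} (hn : 0 < n) (l : Fin n → Fin m → Bool) : Equiv.Perm (S (hC n m)) :=
  a l ⟨0, hn⟩ * ((List.finRange n).map (b l)).prod

/-- A slot is a surface slot if its cubie is on the face its direction points to. -/
def IsSurface {h : ℕ} (s : S h) : Prop :=
  match s.2 with
  | .xp => s.1.1.1 = (h : ℤ)
  | .xn => s.1.1.1 = -(h : ℤ)
  | .yp => s.1.2.1.1 = (h : ℤ)
  | .yn => s.1.2.1.1 = -(h : ℤ)
  | .zp => s.1.2.2.1 = (h : ℤ)
  | .zn => s.1.2.2.1 = -(h : ℤ)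

/-- An STM move: a nontrivial rotation of a single slice. -/
def IsSTM {h : ℕ} (g : Equiv.Perm (S h)) : Prop :=
  ∃ (v : I h) (e : ℕ), (e = 1 ∨ e = 2 ∨ e = 3) ∧
    (g = X v ^ e ∨ g = Y v ^ e ∨ g = Z v ^ e)


/-- The two coordinates of a slot's cubie along the axes other than the axis of its
direction, in the fixed order `x < y < z` of axes. -/
def otherCoords {h : ℕ} (s : S h) : ℤ × ℤ :=
  match s.2 with
  | .xp | .xn => (s.1.2.1.1, s.1.2.2.1)
  | .yp | .yn => (s.1.1.1, s.1.2.2.1)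
  | .zp | .zn => (s.1.1.1, s.1.2.1.1)

/-- Two surface slots are `(p₁, p₂, q)`-paired. -/
def Paired {h : ℕ} (p₁ p₂ q : ℕ) (s₁ s₂ : S h) : Prop :=
  s₁.2 = s₂.2 ∧
    (((otherCoords s₁).1 = (otherCoords s₂).1 ∧ |(otherCoords s₁).1| = (q : ℤ) ∧
        |(otherCoords s₁).2| = (p₁ : ℤ) ∧ |(otherCoords s₂).2| = (p₂ : ℤ) ∧
        (0 < (otherCoords s₁).2 ↔ 0 < (otherCoords s₂).2)) ∨
      ((otherCoords s₁).2 = (otherCoords s₂).2 ∧ |(otherCoords s₁).2| = (q : ℤ) ∧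
        |(otherCoords s₁).1| = (p₁ : ℤ) ∧ |(otherCoords s₂).1| = (p₂ : ℤ) ∧
        (0 < (otherCoords s₁).1 ↔ 0 < (otherCoords s₂).1)))

@[simp] theorem I.val_neg {h : ℕ} (i : I h) : (-i).1 = -i.1 := rfl

theorem I.ext_iff {h : ℕ} {i j : I h} : i = j ↔ i.1 = j.1 := Subtype.ext_iff

theorem I.pos_neg_iff {h : ℕ} (i j : I h) :
    (0 < -i.1 ↔ 0 < -j.1) ↔ (0 < i.1 ↔ 0 < j.1) := by
  have hi := i.2.1
  have hj := j.2.1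
  omega

/-- A quarter turn `X v` maps surface slots to surface slots. -/
theorem IsSurface.X {h : ℕ} (v : I h) {s : S h} (hs : IsSurface s) : IsSurface (RC.X v s) := by
  obtain ⟨⟨x, y, z⟩, d⟩ := s
  simp only [RC.X, Equiv.coe_fn_mk]
  split_ifs
  · cases d <;> simp_all [IsSurface, rotX]
  · exact hs

/-- A quarter turn `X v` of a slice of index other than `p₁` and `p₂` preserves pairedness. -/
theorem Paired.X {h p₁ p₂ q : ℕ} {v : I h} (hv₁ : |v.1| ≠ p₁) (hv₂ : |v.1| ≠ p₂)
    {s₁ s₂ : S h} (hs₁ : IsSurface s₁) (hs₂ : IsSurface s₂) (hp : Paired p₁ p₂ q s₁ s₂) :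
    Paired p₁ p₂ q (RC.X v s₁) (RC.X v s₂) := by
  obtain ⟨⟨x₁, y₁, z₁⟩, d⟩ := s₁
  obtain ⟨⟨x₂, y₂, z₂⟩, d'⟩ := s₂
  obtain rfl : d = d' := hp.1
  have hx := I.pos_neg_iff x₁ x₂
  have hy := I.pos_neg_iff y₁ y₂
  have hz := I.pos_neg_iff z₁ z₂
  cases d <;>
    simp only [Paired, IsSurface, otherCoords, RC.X, Equiv.coe_fn_mk, I.ext_iff] at * <;>
    split_ifs <;> simp only [rotX, I.val_neg, abs_neg] <;> grind

/-- A quarter turn `Y v` maps surface slots to surface slots. -/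
theorem IsSurface.Y {h : ℕ} (v : I h) {s : S h} (hs : IsSurface s) : IsSurface (RC.Y v s) := by
  obtain ⟨⟨x, y, z⟩, d⟩ := s
  simp only [RC.Y, Equiv.coe_fn_mk]
  split_ifs
  · cases d <;> simp_all [IsSurface, rotY]
  · exact hs

/-- A quarter turn `Y v` of a slice of index other than `p₁` and `p₂` preserves pairedness. -/
theorem Paired.Y {h p₁ p₂ q : ℕ} {v : I h} (hv₁ : |v.1| ≠ p₁) (hv₂ : |v.1| ≠ p₂)
    {s₁ s₂ : S h} (hs₁ : IsSurface s₁) (hs₂ : IsSurface s₂) (hp : Paired p₁ p₂ q s₁ s₂) :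
    Paired p₁ p₂ q (RC.Y v s₁) (RC.Y v s₂) := by
  obtain ⟨⟨x₁, y₁, z₁⟩, d⟩ := s₁
  obtain ⟨⟨x₂, y₂, z₂⟩, d'⟩ := s₂
  obtain rfl : d = d' := hp.1
  have hx := I.pos_neg_iff x₁ x₂
  have hy := I.pos_neg_iff y₁ y₂
  have hz := I.pos_neg_iff z₁ z₂
  cases d <;>
    simp only [Paired, IsSurface, otherCoords, RC.Y, Equiv.coe_fn_mk, I.ext_iff] at * <;>
    split_ifs <;> simp only [rotY, I.val_neg, abs_neg] <;> grind

/-- A quarter turn `Z v` maps surface slots to surface slots. -/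
theorem IsSurface.Z {h : ℕ} (v : I h) {s : S h} (hs : IsSurface s) : IsSurface (RC.Z v s) := by
  obtain ⟨⟨x, y, z⟩, d⟩ := s
  simp only [RC.Z, Equiv.coe_fn_mk]
  split_ifs
  · cases d <;> simp_all [IsSurface, rotZ]
  · exact hs

/-- A quarter turn `Z v` of a slice of index other than `p₁` and `p₂` preserves pairedness. -/
theorem Paired.Z {h p₁ p₂ q : ℕ} {v : I h} (hv₁ : |v.1| ≠ p₁) (hv₂ : |v.1| ≠ p₂)
    {s₁ s₂ : S h} (hs₁ : IsSurface s₁) (hs₂ : IsSurface s₂) (hp : Paired p₁ p₂ q s₁ s₂) :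
    Paired p₁ p₂ q (RC.Z v s₁) (RC.Z v s₂) := by
  obtain ⟨⟨x₁, y₁, z₁⟩, d⟩ := s₁
  obtain ⟨⟨x₂, y₂, z₂⟩, d'⟩ := s₂
  obtain rfl : d = d' := hp.1
  have hx := I.pos_neg_iff x₁ x₂
  have hy := I.pos_neg_iff y₁ y₂
  have hz := I.pos_neg_iff z₁ z₂
  cases d <;>
    simp only [Paired, IsSurface, otherCoords, RC.Z, Equiv.coe_fn_mk, I.ext_iff] at * <;>
    split_ifs <;> simp only [rotZ, I.val_neg, abs_neg] <;> grind

/-- If a permutation preserves surface slots and pairedness, so do its powers. -/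
theorem Paired.pow {h p₁ p₂ q : ℕ} {f : Equiv.Perm (S h)}
    (hf : ∀ s, IsSurface s → IsSurface (f s))
    (hfp : ∀ s₁ s₂, IsSurface s₁ → IsSurface s₂ → Paired p₁ p₂ q s₁ s₂ →
      Paired p₁ p₂ q (f s₁) (f s₂))
    (e : ℕ) {s₁ s₂ : S h} (hs₁ : IsSurface s₁) (hs₂ : IsSurface s₂)
    (hp : Paired p₁ p₂ q s₁ s₂) : Paired p₁ p₂ q ((f ^ e) s₁) ((f ^ e) s₂) := by
  induction e generalizing s₁ s₂ with
  | zero => exact hp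
  | succ e ih =>
    rw [pow_succ, Equiv.Perm.mul_apply, Equiv.Perm.mul_apply]
    exact ih (hf _ hs₁) (hf _ hs₂) (hfp _ _ hs₁ hs₂ hp)

/-- an STM move that is not an index-`p₁` or index-`p₂` move moving one of
the two slots preserves `(p₁, p₂, q)`-pairedness. -/
theorem stmt_17 (n m : ℕ) (hn : 0 < n) (hm : 0 < m)
    (p₁ p₂ q : ℕ)
    (hp₁ : 1 ≤ p₁) (hp₁' : p₁ ≤ hC n m - 1)
    (hp₂ : 1 ≤ p₂) (hp₂' : p₂ ≤ hC n m - 1)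
    (hq : 1 ≤ q) (hq' : q ≤ hC n m - 1)
    (hne₁ : p₁ ≠ p₂) (hne₂ : p₁ ≠ q) (hne₃ : p₂ ≠ q)
    (s₁ s₂ : S (hC n m)) (hs₁ : IsSurface s₁) (hs₂ : IsSurface s₂)
    (hpair : Paired p₁ p₂ q s₁ s₂)
    (g : Equiv.Perm (S (hC n m))) (v : I (hC n m)) (e : ℕ)
    (he : e = 1 ∨ e = 2 ∨ e = 3)
    (hg : g = X v ^ e ∨ g = Y v ^ e ∨ g = Z v ^ e)
    (hnot : ¬((|v.1| = (p₁ : ℤ) ∨ |v.1| = (p₂ : ℤ)) ∧ (g s₁ ≠ s₁ ∨ g s₂ ≠ s₂))) :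
    Paired p₁ p₂ q (g s₁) (g s₂) := by
  by_cases hv : |v.1| = (p₁ : ℤ) ∨ |v.1| = (p₂ : ℤ)
  · obtain ⟨h₁, h₂⟩ : g s₁ = s₁ ∧ g s₂ = s₂ := by tauto
    rwa [h₁, h₂]
  · obtain ⟨hv₁, hv₂⟩ := not_or.mp hv
    rcases hg with rfl | rfl | rfl
    · exact Paired.pow (fun _ => IsSurface.X v) (fun _ _ => Paired.X hv₁ hv₂) e hs₁ hs₂ hpair
    · exact Paired.pow (fun _ => IsSurface.Y v) (fun _ _ => Paired.Y hv₁ hv₂) e hs₁ hs₂ hpair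
    · exact Paired.pow (fun _ => IsSurface.Z v) (fun _ _ => Paired.Z hv₁ hv₂) e hs₁ hs₂ hpair

end RC
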